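/- Suppose 1/δ < γ* < +∞, and let (c_n) be any sequence in (0,1) with ζ(c_n) → γ*. Then each G_n(z) := k_n·1_{z ≥ c_n} on (0,1), where k_n := x / ∫_{c_n}^1 F_ρ^{-1}(1-z) dz, is a feasible quantile function, the objective value of G_n equals ζ(c_n)·x, and these objective values converge to γ*·x as n → ∞. -/

import Mathlib

open MeasureTheory Set Filter Topology ENNReal

noncomputable section

/-- The CDF of a random variable `ρ` under the measure `μ`. -/
def cdfFun {Ω : Type*} [MeasurableSpace Ω] (μ : Measure Ω) (ρ : Ω → ℝ) : ℝ → ℝ :=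
  fun t => (μ {ω | ρ ω ≤ t}).toReal

/-- The right-continuous quantile function of `ρ`:
`F_ρ⁻¹(z) = inf {t : F_ρ(t) > z}`. -/
def rcInv {Ω : Type*} [MeasurableSpace Ω] (μ : Measure Ω) (ρ : Ω → ℝ) : ℝ → ℝ :=
  fun z => sInf {t : ℝ | z < cdfFun μ ρ t}

/-- A feasible quantile function for pricing-density `F = F_ρ⁻¹` and initial wealth `x`:
nondecreasing and right-continuous on `(0,1)`, with `lim_{z↓0} G(z) ≥ 0`, satisfying the
budget constraint `∫_0^1 F(1-z) G(z) dz ≤ x`. -/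
def Feasible (F : ℝ → ℝ) (x : ℝ) (G : ℝ → ℝ) : Prop :=
  MonotoneOn G (Set.Ioo 0 1)
  ∧ (∀ z ∈ Set.Ioo (0:ℝ) 1, Filter.Tendsto G (nhdsWithin z (Set.Ioi z)) (nhds (G z)))
  ∧ (∃ L, 0 ≤ L ∧ Filter.Tendsto G (nhdsWithin 0 (Set.Ioi 0)) (nhds L))
  ∧ ∫⁻ z in Set.Ioo (0:ℝ) 1, ENNReal.ofReal (F (1 - z) * G z) ≤ ENNReal.ofReal x

/-- The extension `Ḡ` of a (nonnegative) quantile function `G` from `(0,1)` to `[0,1]`,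
valued in `[0,∞]`, with `Ḡ(0) = lim_{z↓0} G(z)` and `Ḡ(1) = lim_{z↑1} G(z)`
(these limits are the inf/sup over `(0,1)` since `G` is nondecreasing). -/
def Gbar (G : ℝ → ℝ) : ℝ → ℝ≥0∞ := fun z =>
  if z = 0 then ⨅ y ∈ Set.Ioo (0:ℝ) 1, ENNReal.ofReal (G y)
  else if z = 1 then ⨆ y ∈ Set.Ioo (0:ℝ) 1, ENNReal.ofReal (G y)
  else ENNReal.ofReal (G z)

/-- The objective value `∫_{[0,1]} Ḡ(z) m(dz)` of a quantile function `G`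
(for `m` a Borel probability measure carried by `[0,1]`). -/
def objVal (m : Measure ℝ) (G : ℝ → ℝ) : ℝ≥0∞ := ∫⁻ z, Gbar G z ∂m

/-- `ζ(c) = m([c,1]) / ∫_c^1 F(1-z) dz`. -/
def zeta (F : ℝ → ℝ) (m : Measure ℝ) (c : ℝ) : ℝ :=
  (m (Set.Icc c 1)).toReal / ∫ z in c..1, F (1 - z)

theorem cdfFun_eq_cdf {Ω : Type*} [MeasurableSpace Ω] (μ : Measure Ω) [IsProbabilityMeasure μ]
    {ρ : Ω → ℝ} (hρ : Measurable ρ) : cdfFun μ ρ = ProbabilityTheory.cdf (μ.map ρ) := by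
  have := Measure.isProbabilityMeasure_map (μ := μ) hρ.aemeasurable
  ext t
  rw [ProbabilityTheory.cdf_eq_real, measureReal_def, Measure.map_apply hρ measurableSet_Iic]
  rfl

/-- The quantile function of a positive random variable with continuous CDF is positive. -/
theorem rcInv_pos {Ω : Type*} [MeasurableSpace Ω] (μ : Measure Ω) [IsProbabilityMeasure μ]
    {ρ : Ω → ℝ} (hρ : Measurable ρ) (hpos : ∀ ω, 0 < ρ ω) (hcdf : Continuous (cdfFun μ ρ))
    {u : ℝ} (hu : u ∈ Ioo (0 : ℝ) 1) : 0 < rcInv μ ρ u := by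
  have hmono : Monotone (cdfFun μ ρ) := by
    rw [cdfFun_eq_cdf μ hρ]
    exact ProbabilityTheory.monotone_cdf _
  have hzero : cdfFun μ ρ 0 = 0 := by
    have : {ω | ρ ω ≤ 0} = ∅ := eq_empty_of_forall_notMem fun ω h => (hpos ω).not_ge h
    simp [cdfFun, this]
  have htop : Tendsto (cdfFun μ ρ) atTop (𝓝 1) := by
    rw [cdfFun_eq_cdf μ hρ]
    exact ProbabilityTheory.tendsto_cdf_atTop _
  have hne : {t : ℝ | u < cdfFun μ ρ t}.Nonempty := (htop.eventually_const_lt hu.2).exists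
  have hlt : ∀ᶠ t in 𝓝[>] (0 : ℝ), cdfFun μ ρ t < u :=
    (hcdf.continuousAt.eventually_lt_const (by rw [hzero]; exact hu.1)).filter_mono
      nhdsWithin_le_nhds
  obtain ⟨ε, hεu, hε⟩ := (hlt.and self_mem_nhdsWithin).exists
  refine lt_of_lt_of_le hε (le_csInf hne fun t ht => ?_)
  by_contra! h
  exact absurd (hmono h.le) (not_le.2 (hεu.trans ht))

/-- A digital payoff, normalised to exhaust the budget, is feasible. -/
theorem feasible_digital {F : ℝ → ℝ} {x c : ℝ} (hx : 0 < x) (hc : c ∈ Ioo (0 : ℝ) 1)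
    (hF : ∀ z ∈ Ioo c 1, 0 ≤ F (1 - z))
    (hint : IntervalIntegrable (fun z => F (1 - z)) volume c 1)
    (hI : 0 < ∫ t in c..1, F (1 - t)) :
    Feasible F x (fun z => if c ≤ z then x / ∫ t in c..1, F (1 - t) else 0) := by
  set I := ∫ t in c..1, F (1 - t) with hIdef
  have hk : 0 ≤ x / I := (div_pos hx hI).le
  refine ⟨fun a _ b _ hab => ?_, fun z _ => ?_, ⟨0, le_rfl, ?_⟩, ?_⟩
  · dsimp only
    split_ifs with h1 h2
    · exact le_rfl
    · exact absurd (h1.trans hab) h2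
    · exact hk
    · exact le_rfl
  · refine tendsto_const_nhds.congr' ?_
    by_cases hz : c ≤ z
    · filter_upwards [self_mem_nhdsWithin] with y (hy : z < y)
      rw [if_pos hz, if_pos (hz.trans hy.le)]
    · filter_upwards [nhdsWithin_le_nhds (Iio_mem_nhds (not_le.1 hz))] with y (hy : y < c)
      rw [if_neg hz, if_neg hy.not_ge]
  · refine tendsto_const_nhds.congr' ?_
    filter_upwards [nhdsWithin_le_nhds (Iio_mem_nhds hc.1)] with y (hy : y < c)
    rw [if_neg hy.not_ge]
  · have hindicator : (fun z => ENNReal.ofReal (F (1 - z) * if c ≤ z then x / I else 0)) =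
        (Ici c).indicator fun z => ENNReal.ofReal (F (1 - z) * (x / I)) := by
      ext z
      by_cases hz : c ≤ z <;> simp [hz]
    have hinter : Ici c ∩ Ioo 0 1 = Ico c 1 := by
      ext z
      simp only [mem_inter_iff, mem_Ici, mem_Ioo, mem_Ico]
      exact ⟨fun h => ⟨h.1, h.2.2⟩, fun h => ⟨h.1, hc.1.trans_le h.1, h.2⟩⟩
    have hon : IntegrableOn (fun z => F (1 - z)) (Ioo c 1) := by
      rwa [← intervalIntegrable_iff_integrableOn_Ioo_of_le hc.2.le]
    have hnonneg : 0 ≤ᵐ[volume.restrict (Ioo c 1)] fun z => F (1 - z) * (x / I) := by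
      filter_upwards [ae_restrict_mem measurableSet_Ioo] with z hz
      exact mul_nonneg (hF z hz) hk
    rw [hindicator, lintegral_indicator measurableSet_Ici, Measure.restrict_restrict
      measurableSet_Ici, hinter, Measure.restrict_congr_set Ioo_ae_eq_Ico.symm,
      ← ofReal_integral_eq_lintegral_ofReal (hon.mul_const _) hnonneg, integral_mul_const,
      ← integral_Ioc_eq_integral_Ioo, ← intervalIntegral.integral_of_le hc.2.le, ← hIdef,
      mul_div_cancel₀ _ hI.ne']

theorem Gbar_digital {c k : ℝ} (hc : c ∈ Ioo (0 : ℝ) 1) (hk : 0 ≤ k) {z : ℝ}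
    (hz : z ∈ Icc (0 : ℝ) 1) :
    Gbar (fun z => if c ≤ z then k else 0) z =
      (Icc c 1).indicator (fun _ => ENNReal.ofReal k) z := by
  dsimp only [Gbar]
  split_ifs with h0 h1 h
  · rw [indicator_of_notMem (by rw [h0]; exact fun h => hc.1.not_ge h.1)]
    refine le_antisymm (iInf₂_le_of_le (c / 2) ⟨half_pos hc.1, ?_⟩ ?_) zero_le
    · linarith [hc.1, hc.2]
    · rw [if_neg (by linarith [hc.1])]
      simp
  · rw [indicator_of_mem (by rw [h1]; exact ⟨hc.2.le, le_rfl⟩)]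
    refine le_antisymm (iSup₂_le fun y _ => ENNReal.ofReal_le_ofReal ?_)
      (le_iSup₂_of_le c hc ?_)
    · split_ifs
      exacts [le_rfl, hk]
    · rw [if_pos le_rfl]
  · rw [indicator_of_mem (show z ∈ Icc c 1 from ⟨h, hz.2⟩)]
  · rw [indicator_of_notMem (fun h' => h h'.1), ENNReal.ofReal_zero]

theorem objVal_digital (m : Measure ℝ) [IsFiniteMeasure m] (hm : m (Icc (0 : ℝ) 1)ᶜ = 0)
    {c k : ℝ} (hc : c ∈ Ioo (0 : ℝ) 1) (hk : 0 ≤ k) :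
    objVal m (fun z => if c ≤ z then k else 0) =
      ENNReal.ofReal ((m (Icc c 1)).toReal * k) := by
  have hae : Gbar (fun z => if c ≤ z then k else 0) =ᵐ[m]
      (Icc c 1).indicator fun _ => ENNReal.ofReal k := by
    filter_upwards [mem_ae_iff.2 hm] with z hz
    exact Gbar_digital hc hk hz
  rw [objVal, lintegral_congr_ae hae, lintegral_indicator_const measurableSet_Icc, mul_comm,
    ENNReal.ofReal_mul ENNReal.toReal_nonneg, ENNReal.ofReal_toReal (measure_ne_top m _)]

/-- if `1/δ < γ* < +∞` and `(c_n) ⊆ (0,1)` with `ζ(c_n) → γ*`, then each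
`G_n(z) = k_n·1_{z ≥ c_n}` with `k_n = x / ∫_{c_n}^1 F_ρ⁻¹(1-z) dz` is feasible, has
objective value `ζ(c_n)·x`, and these objective values converge to `γ*·x`. -/
theorem digital_sequence_approaches_sup
    {Ω : Type*} [MeasurableSpace Ω] (μ : Measure Ω) [IsProbabilityMeasure μ]
    (ρ : Ω → ℝ) (hρmeas : Measurable ρ) (hρpos : ∀ ω, 0 < ρ ω)
    (hρint : Integrable ρ μ) (hcdf : Continuous (cdfFun μ ρ))
    (m : Measure ℝ) [IsProbabilityMeasure m] (hm : m (Set.Icc (0:ℝ) 1)ᶜ = 0)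
    (x δ : ℝ) (hx : 0 < x) (hδpos : 0 < δ)
    (hδ1 : δ = ∫ ω, ρ ω ∂μ) (hδ2 : δ = ∫ z in (0:ℝ)..1, rcInv μ ρ (1 - z))
    (γstar : ℝ) (hlub : IsLUB (zeta (rcInv μ ρ) m '' Set.Ioo 0 1) γstar)
    (hgt : 1 / δ < γstar)
    (c : ℕ → ℝ) (hc : ∀ n, c n ∈ Set.Ioo (0:ℝ) 1)
    (hcγ : Filter.Tendsto (fun n => zeta (rcInv μ ρ) m (c n)) Filter.atTop (nhds γstar)) :
    (∀ n : ℕ,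
      Feasible (rcInv μ ρ) x
          (fun z => if c n ≤ z then x / ∫ t in (c n)..1, rcInv μ ρ (1 - t) else 0)
      ∧ objVal m (fun z => if c n ≤ z then x / ∫ t in (c n)..1, rcInv μ ρ (1 - t) else 0)
          = ENNReal.ofReal (zeta (rcInv μ ρ) m (c n) * x))
    ∧ Filter.Tendsto
        (fun n => objVal m (fun z => if c n ≤ z then x / ∫ t in (c n)..1, rcInv μ ρ (1 - t) else 0))
        Filter.atTop (nhds (ENNReal.ofReal (γstar * x))) := by
  have hint : IntervalIntegrable (fun z => rcInv μ ρ (1 - z)) volume 0 1 := by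
    by_contra h
    exact hδpos.ne' (hδ2.trans (intervalIntegral.integral_undef h))
  have hpos : ∀ n, ∀ z ∈ Ioo (c n) 1, 0 < rcInv μ ρ (1 - z) := fun n z hz =>
    rcInv_pos μ hρmeas hρpos hcdf ⟨by linarith [hz.2], by linarith [hz.1, (hc n).1]⟩
  have hintc : ∀ n, IntervalIntegrable (fun z => rcInv μ ρ (1 - z)) volume (c n) 1 := fun n =>
    hint.mono_set (by
      rw [uIcc_of_le (hc n).2.le, uIcc_of_le zero_le_one]
      exact Icc_subset_Icc_left (hc n).1.le)
  have hI : ∀ n, 0 < ∫ t in (c n)..1, rcInv μ ρ (1 - t) := fun n =>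
    intervalIntegral.intervalIntegral_pos_of_pos_on (hintc n) (hpos n) (hc n).2
  have hobj : ∀ n,
      objVal m (fun z => if c n ≤ z then x / ∫ t in (c n)..1, rcInv μ ρ (1 - t) else 0)
        = ENNReal.ofReal (zeta (rcInv μ ρ) m (c n) * x) := fun n => by
    rw [objVal_digital m hm (hc n) (div_pos hx (hI n)).le, zeta, mul_div_assoc',
      div_mul_eq_mul_div]
  refine ⟨fun n => ⟨feasible_digital hx (hc n) (fun z hz => (hpos n z hz).le) (hintc n) (hI n),
    hobj n⟩, ?_⟩
  simp_rw [hobj]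
  exact ENNReal.tendsto_ofReal (hcγ.mul_const x)
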